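/- Gain-term estimate (inequalities 'eq:uniq-flory-plus-bound' and 'eq:flory-unique-first'): let K be a coagulation kernel on E and φ : E × E → [0,∞) Borel measurable, symmetric and conservative with respect to K, with K̄(x,y) ≤ c' φ(x,y) for all x,y and some constant c' > 0. Let μ_0, ν, ν̂ be finite positive Borel measures on E such that for every x ∈ E, ∫ φ(x,u) ν(du) ≤ ∫ φ(x,u) μ_0(du) and ∫ φ(x,u) ν̂(du) ≤ ∫ φ(x,u) μ_0(du). Let R > 0 and D_R := {x ∈ E : ∫ φ(x,y) μ_0(dy) ≤ R}. Then for every Borel measurable f : E → ℝ with |f| ≤ 1, | (1/2) ∫_{E×E×E} f(z) 1_{D_R}(z) K(u,v,dz) d(ν⊗ν)(u,v) − (1/2) ∫_{E×E×E} f(z) 1_{D_R}(z) K(u,v,dz) d(ν̂⊗ν̂)(u,v) | ≤ c' R ∫_E 1_{D_R}(v) d|ν − ν̂|(v). -/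

import Mathlib

open MeasureTheory Set

noncomputable section

/-- `K̄(x,y) := K(x,y,E)`, the total coagulation rate, as a real number. -/
def Kbar {E : Type*} [MeasurableSpace E] (K : E → E → Measure E) (x y : E) : ℝ :=
  (K x y Set.univ).toReal

/-- `φ` is conservative with respect to the coagulation kernel `K`. -/
def Conservative {E : Type*} [MeasurableSpace E] (K : E → E → Measure E)
    (φ : E → E → ℝ) : Prop :=
  ∀ x y q : E, ∀ᵐ z ∂(K x y), φ z q = φ x q + φ y q

/-- The sublevel set `D_R := {x ∈ E : ∫ φ(x,y) μ₀(dy) ≤ R}`. -/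
def Dset {E : Type*} [MeasurableSpace E] (φ : E → E → ℝ) (μ₀ : Measure E) (r : ℝ) :
    Set E :=
  {x : E | ∫⁻ y, ENNReal.ofReal (φ x y) ∂μ₀ ≤ ENNReal.ofReal r}

/-- The difference of the integrals of a bounded function supported in `D` is controlled by the
total variation of the difference of the measures on `D`. -/
theorem abs_integral_sub_integral_le_totalVariation {E : Type*} [MeasurableSpace E]
    (μ ν : Measure E) [IsFiniteMeasure μ] [IsFiniteMeasure ν] {D : Set E}
    (hD : MeasurableSet D) {C : ℝ} {h : E → ℝ} (hh : Measurable h)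
    (hbound : ∀ x, |h x| ≤ D.indicator (fun _ => C) x) :
    |∫ x, h x ∂μ - ∫ x, h x ∂ν|
      ≤ C * ((μ.toSignedMeasure - ν.toSignedMeasure).totalVariation D).toReal := by
  set s := μ.toSignedMeasure - ν.toSignedMeasure
  set P := s.toJordanDecomposition.posPart
  set N := s.toJordanDecomposition.negPart
  have hint : ∀ (ρ : Measure E) [IsFiniteMeasure ρ], Integrable h ρ := fun ρ _ =>
    ((integrable_const C).indicator hD).mono' hh.aestronglyMeasurable (.of_forall hbound)
  have hle : ∀ (ρ : Measure E) [IsFiniteMeasure ρ], |∫ x, h x ∂ρ| ≤ C * (ρ D).toReal := by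
    intro ρ _
    calc |∫ x, h x ∂ρ| ≤ ∫ x, D.indicator (fun _ => C) x ∂ρ := by
          rw [← Real.norm_eq_abs]
          exact norm_integral_le_of_norm_le ((integrable_const C).indicator hD) (.of_forall hbound)
      _ = C * (ρ D).toReal := by
          rw [integral_indicator_const _ hD, smul_eq_mul, mul_comm, measureReal_def]
  have hsum : μ + N = ν + P := by
    have hdecomp : P.toSignedMeasure - N.toSignedMeasure = s :=
      s.toSignedMeasure_toJordanDecomposition
    rw [← Measure.toSignedMeasure_eq_toSignedMeasure_iff, Measure.toSignedMeasure_add,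
      Measure.toSignedMeasure_add]
    rw [add_comm ν.toSignedMeasure]
    exact sub_eq_sub_iff_add_eq_add.1 hdecomp.symm
  have heq : ∫ x, h x ∂μ - ∫ x, h x ∂ν = ∫ x, h x ∂P - ∫ x, h x ∂N := by
    have := congrArg (fun ρ => ∫ x, h x ∂ρ) hsum
    simp only [integral_add_measure (hint _) (hint _)] at this
    linarith
  rw [heq, SignedMeasure.totalVariation, Measure.add_apply,
    ENNReal.toReal_add (measure_ne_top _ _) (measure_ne_top _ _), mul_add]
  exact (abs_sub _ _).trans (add_le_add (hle P) (hle N))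

/-- Bilinear version: for a symmetric `g` whose marginal `L¹` norms against `μ` and `ν` are at most
`C` on `D` and vanish off `D`, the integrals against `μ ⊗ μ` and `ν ⊗ ν` differ by at most
`2 C |μ - ν|(D)`. -/
theorem abs_integral_prod_self_sub_le_totalVariation {E : Type*} [MeasurableSpace E]
    (μ ν : Measure E) [IsFiniteMeasure μ] [IsFiniteMeasure ν] {D : Set E}
    (hD : MeasurableSet D) {C : ℝ} (hC : 0 ≤ C) {g : E × E → ℝ} (hg : Measurable g)
    (hsymm : ∀ p : E × E, g p.swap = g p)
    (hμ : ∀ v, ∫⁻ u, ‖g (u, v)‖ₑ ∂μ ≤ D.indicator (fun _ => ENNReal.ofReal C) v)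
    (hν : ∀ v, ∫⁻ u, ‖g (u, v)‖ₑ ∂ν ≤ D.indicator (fun _ => ENNReal.ofReal C) v) :
    |∫ p, g p ∂(μ.prod μ) - ∫ p, g p ∂(ν.prod ν)|
      ≤ 2 * C * ((μ.toSignedMeasure - ν.toSignedMeasure).totalVariation D).toReal := by
  have hint : ∀ (α β : Measure E) [IsFiniteMeasure α] [IsFiniteMeasure β],
      (∀ v, ∫⁻ u, ‖g (u, v)‖ₑ ∂α ≤ D.indicator (fun _ => ENNReal.ofReal C) v) →
      Integrable g (α.prod β) := by
    intro α β _ _ hα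
    refine ⟨hg.aestronglyMeasurable, ?_⟩
    rw [HasFiniteIntegral, lintegral_prod_symm' _ hg.enorm]
    refine (lintegral_mono hα).trans_lt ?_
    rw [lintegral_indicator_const hD]
    exact ENNReal.mul_lt_top ENNReal.ofReal_lt_top (measure_lt_top _ _)
  have hmarg : ∀ (α : Measure E) [IsFiniteMeasure α],
      (∀ v, ∫⁻ u, ‖g (u, v)‖ₑ ∂α ≤ D.indicator (fun _ => ENNReal.ofReal C) v) →
      |∫ p, g p ∂(α.prod μ) - ∫ p, g p ∂(α.prod ν)|
        ≤ C * ((μ.toSignedMeasure - ν.toSignedMeasure).totalVariation D).toReal := by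
    intro α _ hα
    rw [integral_prod_symm _ (hint α μ hα), integral_prod_symm _ (hint α ν hα)]
    refine abs_integral_sub_integral_le_totalVariation μ ν hD
      hg.stronglyMeasurable.integral_prod_left'.measurable fun v => ?_
    have hle : ‖∫ u, g (u, v) ∂α‖ₑ ≤ ENNReal.ofReal (D.indicator (fun _ => C) v) := by
      refine (enorm_integral_le_lintegral_enorm _).trans ((hα v).trans_eq ?_)
      by_cases hv : v ∈ D <;> simp [hv]
    rw [← ofReal_norm] at hle
    exact (ENNReal.ofReal_le_ofReal_iff (indicator_nonneg (fun _ _ => hC) v)).1 hle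
  have hswap : ∫ p, g p ∂(μ.prod ν) = ∫ p, g p ∂(ν.prod μ) := by
    rw [← integral_prod_swap]
    simp only [hsymm]
  have h₁ := hmarg μ hμ
  have h₂ := hmarg ν hν
  rw [hswap] at h₁
  calc _ ≤ _ := abs_sub_le _ (∫ p, g p ∂(ν.prod μ)) _
    _ ≤ _ := add_le_add h₁ h₂
    _ = _ := by ring

/-- Integrating a bounded measurable function against a measurable family of finite measures gives
a measurable function. -/
theorem measurable_integral_of_measurable_measure {X E : Type*} [MeasurableSpace X]
    [MeasurableSpace E] {κ : X → Measure E} (hκ : Measurable κ) (hfin : ∀ x, IsFiniteMeasure (κ x))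
    {F : E → ℝ} (hF : Measurable F) {C : ℝ} (hbound : ∀ z, |F z| ≤ C) :
    Measurable fun x => ∫ z, F z ∂(κ x) := by
  have hint : ∀ x, Integrable F (κ x) := fun x =>
    .of_bound hF.aestronglyMeasurable C (.of_forall hbound)
  simp only [fun x => integral_eq_lintegral_pos_part_sub_lintegral_neg_part (hint x)]
  exact ((Measure.measurable_lintegral hF.ennreal_ofReal).comp hκ).ennreal_toReal.sub
    ((Measure.measurable_lintegral hF.neg.ennreal_ofReal).comp hκ).ennreal_toReal

theorem measurableSet_Dset {E : Type*} [MeasurableSpace E] {φ : E → E → ℝ}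
    (hφ : Measurable fun p : E × E => φ p.1 p.2) (μ₀ : Measure E) [SFinite μ₀] (r : ℝ) :
    MeasurableSet (Dset φ μ₀ r) :=
  measurableSet_le (Measurable.lintegral_prod_right' hφ.ennreal_ofReal) measurable_const

/-- Coagulation of `x` and `y` a.s. produces a particle in `D_r` only if `x` is in `D_r`. -/
theorem Conservative.ae_mem_Dset_imp {E : Type*} [MeasurableSpace E] {K : E → E → Measure E}
    {φ : E → E → ℝ} (h : Conservative K φ) (hφ : Measurable fun p : E × E => φ p.1 p.2)
    (hφ_nonneg : ∀ x y, 0 ≤ φ x y) (μ₀ : Measure E) [SFinite μ₀] (r : ℝ) (x y : E)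
    [SFinite (K x y)] :
    ∀ᵐ z ∂(K x y), z ∈ Dset φ μ₀ r → x ∈ Dset φ μ₀ r := by
  have hmeas : MeasurableSet {p : E × E | φ p.1 p.2 = φ x p.2 + φ y p.2} := by
    have hx : ∀ x, Measurable (φ x) := fun x => hφ.comp measurable_prodMk_left
    exact measurableSet_eq_fun hφ
      (((hx x).comp measurable_snd).add ((hx y).comp measurable_snd))
  have hae : ∀ᵐ z ∂(K x y), ∀ᵐ q ∂μ₀, φ z q = φ x q + φ y q :=
    (Measure.ae_ae_comm hmeas).2 (.of_forall (h x y))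
  filter_upwards [hae] with z hz hzD
  refine le_trans (lintegral_mono_ae ?_) hzD
  filter_upwards [hz] with q hq
  exact ENNReal.ofReal_le_ofReal (by linarith [hφ_nonneg y q])

/-- **Gain-term estimate** (inequalities `eq:uniq-flory-plus-bound` and
`eq:flory-unique-first`): for `|f| ≤ 1`,
`|(1/2)∫∫∫ f(z) 1_{D_R}(z) K(u,v,dz) d(ν⊗ν) − (1/2)∫∫∫ f(z) 1_{D_R}(z) K(u,v,dz) d(ν̂⊗ν̂)|
  ≤ c' R ∫ 1_{D_R} d|ν − ν̂|`. -/
theorem gain_term_estimate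
    {E : Type*} [MetricSpace E] [MeasurableSpace E] [BorelSpace E]
    [SigmaCompactSpace E]
    (K : E → E → Measure E)
    (hK_meas : ∀ A : Set E, MeasurableSet A →
      Measurable fun p : E × E => K p.1 p.2 A)
    (hK_fin : ∀ x y, IsFiniteMeasure (K x y))
    (hK_symm : ∀ x y, K x y = K y x)
    (φ : E → E → ℝ)
    (hφ_meas : Measurable fun p : E × E => φ p.1 p.2)
    (hφ_nonneg : ∀ x y, 0 ≤ φ x y)
    (hφ_symm : ∀ x y, φ x y = φ y x)
    (hφ_cons : Conservative K φ)
    (c' : ℝ) (hc' : 0 < c')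
    (hKφ : ∀ x y, Kbar K x y ≤ c' * φ x y)
    (μ₀ ν νhat : Measure E)
    [IsFiniteMeasure μ₀] [IsFiniteMeasure ν] [IsFiniteMeasure νhat]
    (hν : ∀ x : E, ∫⁻ u, ENNReal.ofReal (φ x u) ∂ν
        ≤ ∫⁻ u, ENNReal.ofReal (φ x u) ∂μ₀)
    (hνhat : ∀ x : E, ∫⁻ u, ENNReal.ofReal (φ x u) ∂νhat
        ≤ ∫⁻ u, ENNReal.ofReal (φ x u) ∂μ₀)
    (R : ℝ) (hR : 0 < R)
    (f : E → ℝ) (hf_meas : Measurable f) (hf_bdd : ∀ x, |f x| ≤ 1) :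
    |(1 / 2) * ∫ p : E × E,
          (∫ z, Set.indicator (Dset φ μ₀ R) f z ∂(K p.1 p.2)) ∂(ν.prod ν)
      - (1 / 2) * ∫ p : E × E,
          (∫ z, Set.indicator (Dset φ μ₀ R) f z ∂(K p.1 p.2)) ∂(νhat.prod νhat)|
      ≤ c' * R *
          ((ν.toSignedMeasure - νhat.toSignedMeasure).totalVariation
            (Dset φ μ₀ R)).toReal := by
  have hD := measurableSet_Dset hφ_meas μ₀ R
  set D := Dset φ μ₀ R
  have hF_bdd : ∀ z, |D.indicator f z| ≤ 1 := fun z => by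
    by_cases hz : z ∈ D <;> simp [hz, hf_bdd z]
  set g : E × E → ℝ := fun p => ∫ z, D.indicator f z ∂(K p.1 p.2) with hg
  have hg_meas : Measurable g :=
    measurable_integral_of_measurable_measure
      (Measure.measurable_of_measurable_coe _ fun A hA => hK_meas A hA)
      (fun p => hK_fin p.1 p.2) (hf_meas.indicator hD) hF_bdd
  have hg_symm : ∀ p : E × E, g p.swap = g p := fun p => by
    simp only [hg, Prod.fst_swap, Prod.snd_swap, hK_symm p.2 p.1]
  have hg_le : ∀ u v, ‖g (u, v)‖ₑ ≤ ENNReal.ofReal c' * ENNReal.ofReal (φ v u) := by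
    intro u v
    have := hK_fin u v
    have hle : |g (u, v)| ≤ c' * φ v u := by
      have hnorm : |g (u, v)| ≤ 1 * (K u v).real univ := by
        rw [← Real.norm_eq_abs]
        exact norm_integral_le_of_norm_le_const (.of_forall hF_bdd)
      rw [one_mul] at hnorm
      exact hφ_symm u v ▸ hnorm.trans (hKφ u v)
    rw [← ofReal_norm, ← ENNReal.ofReal_mul hc'.le]
    exact ENNReal.ofReal_le_ofReal hle
  have hg_zero : ∀ u, ∀ v ∉ D, g (u, v) = 0 := by
    intro u v hv
    have := hK_fin v u
    rw [← hg_symm]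
    refine integral_eq_zero_of_ae ?_
    filter_upwards [hφ_cons.ae_mem_Dset_imp hφ_meas hφ_nonneg μ₀ R v u] with z hz
    exact indicator_of_notMem (fun hzD => hv (hz hzD)) f
  have hmarg : ∀ α : Measure E,
      (∀ x, ∫⁻ u, ENNReal.ofReal (φ x u) ∂α ≤ ∫⁻ u, ENNReal.ofReal (φ x u) ∂μ₀) →
      ∀ v, ∫⁻ u, ‖g (u, v)‖ₑ ∂α ≤ D.indicator (fun _ => ENNReal.ofReal (c' * R)) v := by
    intro α hα v
    by_cases hv : v ∈ D
    · rw [indicator_of_mem hv, ENNReal.ofReal_mul hc'.le]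
      calc ∫⁻ u, ‖g (u, v)‖ₑ ∂α
          ≤ ∫⁻ u, ENNReal.ofReal c' * ENNReal.ofReal (φ v u) ∂α :=
            lintegral_mono fun u => hg_le u v
        _ = ENNReal.ofReal c' * ∫⁻ u, ENNReal.ofReal (φ v u) ∂α :=
            lintegral_const_mul' _ _ ENNReal.ofReal_ne_top
        _ ≤ ENNReal.ofReal c' * ENNReal.ofReal R := by
            gcongr
            exact (hα v).trans hv
    · simp [hg_zero _ v hv]
  have hmain := abs_integral_prod_self_sub_le_totalVariation ν νhat hD (mul_pos hc' hR).le
    hg_meas hg_symm (hmarg ν hν) (hmarg νhat hνhat)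
  rw [← mul_sub, abs_mul, abs_of_pos (by norm_num : (0 : ℝ) < 1 / 2)]
  linarith
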